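/- Let C be any class of finite structures over a fixed schema with k distinguished elements that is closed under direct products. If a structure (A,\mathbf{a}) ∈ C has a finite frontier with respect to C, then (A,\mathbf{a}) has a finite duality with respect to C. -/

import Mathlib

/-- A finite relational structure over a schema `S` (with arity function `ar`)
with `k` distinguished elements. -/
structure PStruct (S : Type) (ar : S → ℕ) (k : ℕ) : Type 1 where
  dom : Type
  finite : Finite dom
  facts : ∀ R : S, Set (Fin (ar R) → dom)
  dist : Fin k → dom

attribute [instance] PStruct.finite

namespace PStruct

variable {S : Type} {ar : S → ℕ} {k : ℕ}

/-- `h` is a homomorphism from `A` to `B`: it preserves all facts and maps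
distinguished elements to corresponding distinguished elements. -/
def IsHom (A B : PStruct S ar k) (h : A.dom → B.dom) : Prop :=
  (∀ (R : S) (t : Fin (ar R) → A.dom), t ∈ A.facts R → (fun i => h (t i)) ∈ B.facts R) ∧
  ∀ i : Fin k, h (A.dist i) = B.dist i

/-- `(A,𝐚) → (B,𝐛)`: a homomorphism exists. -/
def HomTo (A B : PStruct S ar k) : Prop := ∃ h, IsHom A B h

/-- Homomorphic equivalence. -/
def HomEquiv (A B : PStruct S ar k) : Prop := HomTo A B ∧ HomTo B A

/-- Direct product of two structures with distinguished elements. -/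
def prod (A B : PStruct S ar k) : PStruct S ar k where
  dom := A.dom × B.dom
  finite := inferInstance
  facts R := {t | (fun i => (t i).1) ∈ A.facts R ∧ (fun i => (t i).2) ∈ B.facts R}
  dist i := (A.dist i, B.dist i)

/-- The facts of a structure, as a type. -/
def Fact (A : PStruct S ar k) : Type := Σ R : S, {t : Fin (ar R) → A.dom // t ∈ A.facts R}

/-- Occurrences of elements in facts: a fact together with a position in it. -/
def Occ (A : PStruct S ar k) : Type :=
  Σ R : S, {t : Fin (ar R) → A.dom // t ∈ A.facts R} × Fin (ar R)

def Occ.fact {A : PStruct S ar k} (o : Occ A) : Fact A := ⟨o.1, o.2.1⟩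

def Occ.elem {A : PStruct S ar k} (o : Occ A) : A.dom := o.2.1.1 o.2.2

/-- Vertices of the (subdivided) incidence graph: elements, occurrences, and facts.
Each occurrence vertex subdivides one edge of the bipartite incidence multigraph,
so that cycles (resp. connectivity) of the incidence multigraph correspond exactly to
cycles (resp. connectivity) of this simple graph. -/
def IncV (A : PStruct S ar k) : Type := A.dom ⊕ (Occ A ⊕ Fact A)

/-- The incidence graph of a structure, as a simple graph (with each
element-occurrence-in-a-fact edge of the incidence multigraph subdivided). -/
def incGraph (A : PStruct S ar k) : SimpleGraph (IncV A) where
  Adj v w := ∃ o : Occ A,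
    (v = Sum.inl o.elem ∧ w = Sum.inr (Sum.inl o)) ∨
    (w = Sum.inl o.elem ∧ v = Sum.inr (Sum.inl o)) ∨
    (v = Sum.inr (Sum.inl o) ∧ w = Sum.inr (Sum.inr o.fact)) ∨
    (w = Sum.inr (Sum.inl o) ∧ v = Sum.inr (Sum.inr o.fact))
  symm := by
    refine ⟨?_⟩
    rintro v w ⟨o, h⟩
    exact ⟨o, by tauto⟩
  loopless := by
    refine ⟨?_⟩
    rintro v ⟨o, (⟨h1, h2⟩ | ⟨h1, h2⟩ | ⟨h1, h2⟩ | ⟨h1, h2⟩)⟩ <;> rw [h1] at h2 <;>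
      first
      | exact nomatch h2
      | · rw [Sum.inr.injEq] at h2
          exact Sum.noConfusion h2

/-- A structure is acyclic if its incidence graph is acyclic (Berge acyclicity). -/
def Acyclic (A : PStruct S ar k) : Prop := (incGraph A).IsAcyclic

/-- A structure is c-acyclic if every cycle of its incidence graph passes through
a distinguished element. -/
def CAcyclic (A : PStruct S ar k) : Prop :=
  ∀ (v : IncV A) (c : (incGraph A).Walk v v), c.IsCycle →
    ∃ i : Fin k, Sum.inl (A.dist i) ∈ c.support

/-- A structure is c-connected if every connected component of its incidence graph
contains a distinguished element. -/
def CConnected (A : PStruct S ar k) : Prop :=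
  ∀ v : IncV A, ∃ i : Fin k, (incGraph A).Reachable (Sum.inl (A.dist i)) v

/-- The incidence graph is connected. -/
def IncConnected (A : PStruct S ar k) : Prop := (incGraph A).Connected

/-- The fact graph: vertices are facts, with an edge between distinct facts that
share a non-distinguished element. -/
def factGraph (A : PStruct S ar k) : SimpleGraph (Fact A) where
  Adj f g := f ≠ g ∧ ∃ b : A.dom, (∀ i, b ≠ A.dist i) ∧ (∃ j, f.2.1 j = b) ∧ (∃ j, g.2.1 j = b)
  symm := by
    refine ⟨?_⟩
    rintro f g ⟨hne, b, h1, h2, h3⟩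
    exact ⟨hne.symm, b, h1, h3, h2⟩
  loopless := by refine ⟨?_⟩; rintro f ⟨hne, -⟩; exact hne rfl

/-- A structure is fg-connected if its fact graph is connected. -/
def FgConnected (A : PStruct S ar k) : Prop := (factGraph A).Connected

/-- A structure is a core if it admits no homomorphism to a proper substructure,
i.e. every endomorphism is surjective on elements and on facts. -/
def IsCore (A : PStruct S ar k) : Prop :=
  ∀ h : A.dom → A.dom, IsHom A A h →
    Function.Surjective h ∧
    ∀ (R : S) (t : Fin (ar R) → A.dom), t ∈ A.facts R →
      ∃ s ∈ A.facts R, (fun i => h (s i)) = t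

/-- Unique Names Property: the distinguished elements are pairwise distinct. -/
def UNP (A : PStruct S ar k) : Prop := Function.Injective A.dist

/-- A structure is safe if every distinguished element occurs in at least one fact. -/
def Safe (A : PStruct S ar k) : Prop :=
  ∀ i : Fin k, ∃ (R : S) (t : Fin (ar R) → A.dom), t ∈ A.facts R ∧ ∃ j, t j = A.dist i

/-- A structure is (the canonical structure of) a conjunctive query iff every element
occurs in at least one fact (in particular it is safe). -/
def IsCQ (A : PStruct S ar k) : Prop :=
  ∀ x : A.dom, ∃ (R : S) (t : Fin (ar R) → A.dom), t ∈ A.facts R ∧ ∃ j, t j = x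

/-- The size of a structure: its number of facts. -/
noncomputable def size (A : PStruct S ar k) : ℕ := Nat.card (Fact A)

/-- The total size of a set of structures: the sum of (size + 1) over its members. -/
noncomputable def totalSize (F : Set (PStruct S ar k)) : ℕ := ∑ᶠ B ∈ F, (size B + 1)

/-- `F` is a frontier for `A` with respect to the class `C`. -/
def IsFrontier (C : Set (PStruct S ar k)) (A : PStruct S ar k)
    (F : Set (PStruct S ar k)) : Prop :=
  F.Finite ∧
  (∀ B ∈ F, HomTo B A) ∧
  (∀ B ∈ F, ¬ HomTo A B) ∧
  ∀ C' ∈ C, HomTo C' A → ¬ HomTo A C' → ∃ B ∈ F, HomTo C' B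

/-- `D` is a finite duality for `A` with respect to the class `C`. -/
def IsDuality (C : Set (PStruct S ar k)) (A : PStruct S ar k)
    (D : Set (PStruct S ar k)) : Prop :=
  D.Finite ∧ ∀ C' ∈ C, (HomTo A C' ↔ ∀ B ∈ D, ¬ HomTo C' B)

/-- A conjunctive query (given by its canonical structure `Q`) fits the example sets
`(E⁺, E⁻)`: every example in `E⁺` is positive and every example in `E⁻` is negative.
(By Chandra–Merlin, `(A,𝐚)` is a positive example for `Q` iff `Q → (A,𝐚)`.) -/
def Fits (Q : PStruct S ar k) (Ep Em : Set (PStruct S ar k)) : Prop :=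
  (∀ E ∈ Ep, HomTo Q E) ∧ (∀ E ∈ Em, ¬ HomTo Q E)

/-- `(E⁺, E⁻)` uniquely characterizes the CQ `Q` with respect to the class `C` of CQs
(all represented by their canonical structures): `Q` fits, and every member of `C`
that fits is logically equivalent (i.e. homomorphically equivalent) to `Q`. -/
def UniquelyCharacterizes (Ep Em : Set (PStruct S ar k)) (Q : PStruct S ar k)
    (C : Set (PStruct S ar k)) : Prop :=
  Fits Q Ep Em ∧ ∀ Q' ∈ C, Fits Q' Ep Em → HomEquiv Q Q'

end PStruct

open PStruct

/-- The exponential structure `B ^ A`, with chosen distinguished functions. -/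
def PStruct.expo {S : Type} {ar : S → ℕ} {k : ℕ} (A B : PStruct S ar k)
    (d : Fin k → A.dom → B.dom) : PStruct S ar k where
  dom := A.dom → B.dom
  finite := inferInstance
  facts R := {f | ∀ t ∈ A.facts R, (fun i => f i (t i)) ∈ B.facts R}
  dist := d

theorem PStruct.exists_homTo_expo {S : Type} {ar : S → ℕ} {k : ℕ} (A B X : PStruct S ar k) :
    (∃ d : Fin k → A.dom → B.dom, (∀ i, d i (A.dist i) = B.dist i) ∧ HomTo X (expo A B d)) ↔
      HomTo (A.prod X) B := by
  constructor
  · rintro ⟨d, hd, h, h1, h2⟩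
    refine ⟨fun p => h p.2 p.1, ?_, ?_⟩
    · rintro R t ⟨ht1, ht2⟩
      exact h1 R _ ht2 _ ht1
    · intro i
      change h (X.dist i) (A.dist i) = _
      rw [h2 i]
      exact hd i
  · rintro ⟨h, h1, h2⟩
    refine ⟨fun i a => h (a, X.dist i), fun i => h2 i, fun x a => h (a, x), ?_, ?_⟩
    · intro R t ht s hs
      exact h1 R (fun i => (s i, t i)) ⟨hs, ht⟩
    · intro i
      rfl

/-- If `C` is closed under direct products and `(A,𝐚) ∈ C` has a finite frontier
w.r.t. `C`, then `(A,𝐚)` has a finite duality w.r.t. `C`. -/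
theorem stmt_2 {S : Type} {ar : S → ℕ} {k : ℕ}
    (C : Set (PStruct S ar k)) (hC : ∀ X ∈ C, ∀ Y ∈ C, X.prod Y ∈ C)
    (A : PStruct S ar k) (hA : A ∈ C)
    (hF : ∃ F, IsFrontier C A F) :
    ∃ D, IsDuality C A D := by
  obtain ⟨F, hfin, hFA, hAF, hcov⟩ := hF
  refine ⟨⋃ B ∈ F, (expo A B) '' {d | ∀ i, d i (A.dist i) = B.dist i}, ?_, ?_⟩
  · exact hfin.biUnion fun B _ => (Set.toFinite _).image _
  · intro X hX
    constructor
    · rintro ⟨g, g1, g2⟩ E hE hXE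
      simp only [Set.mem_iUnion] at hE
      obtain ⟨B, hB, d, hd, rfl⟩ := hE
      obtain ⟨h, h1, h2⟩ := (exists_homTo_expo A B X).1 ⟨d, hd, hXE⟩
      refine hAF B hB ⟨fun a => h (a, g a), ?_, ?_⟩
      · intro R t ht
        exact h1 R (fun i => (t i, g (t i))) ⟨ht, g1 R t ht⟩
      · intro i
        change h (A.dist i, g (A.dist i)) = _
        rw [g2 i]
        exact h2 i
    · intro hD
      by_contra hn
      obtain ⟨B, hB, hPB⟩ := hcov (A.prod X) (hC A hA X hX)
        ⟨Prod.fst, fun R t ht => ht.1, fun i => rfl⟩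
        (by
          rintro ⟨h, h1, h2⟩
          exact hn ⟨fun a => (h a).2, fun R t ht => (h1 R t ht).2,
            fun i => congrArg Prod.snd (h2 i)⟩)
      obtain ⟨d, hd, hXd⟩ := (exists_homTo_expo A B X).2 hPB
      exact hD _ (Set.mem_biUnion hB ⟨d, hd, rfl⟩) hXd
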